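/- Suppose (A,W) ∈ T(r,C₀). Then for every μ ≥ 1 there exist a sequence of real-valued functions (φ_j) in C_0^∞(ℝ^d) and a sequence of points (x_j) in ℝ^d such that: (i) Σ_j φ_j(x)² = 1 for all x ∈ ℝ^d; (ii) supp φ_j ⊂ B(x_j, R(x_j,μ)) for every j; (iii) for every multi-index α there exists Ĉ_α > 0, independent of μ, with Σ_j |∂^α φ_j(x)|² ≤ Ĉ_α R(x,μ)^{−2|α|} for all x; (iv) there exists Ĉ > 0, independent of μ, such that for k = 1, 2 and every u ∈ C_0^∞(ℝ^d), ∫_{ℝ^d} |u(x)|² R(x,μ)^{−2k} dx ≤ Ĉ Σ_j ∫_{ℝ^d} φ_j(x)² |u(x)|² R(x_j,μ)^{−2k} dx. -/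

import Mathlib

open MeasureTheory Real Filter

noncomputable section

/-- `ℝ^d` with the Euclidean structure. -/
abbrev Rd (d : ℕ) := EuclideanSpace ℝ (Fin d)

/-- Partial derivative `∂_{x_j}` of a complex-valued function. -/
def pdC {d : ℕ} (j : Fin d) (f : Rd d → ℂ) : Rd d → ℂ :=
  fun x => fderiv ℝ f x (EuclideanSpace.single j (1:ℝ))

/-- Partial derivative `∂_{x_j}` of a real-valued function. -/
def pdR {d : ℕ} (j : Fin d) (f : Rd d → ℝ) : Rd d → ℝ :=
  fun x => fderiv ℝ f x (EuclideanSpace.single j (1:ℝ))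

/-- Iterated partial derivative in the `j`-th direction. -/
def pdIter {d : ℕ} (j : Fin d) : ℕ → (Rd d → ℝ) → (Rd d → ℝ)
  | 0, f => f
  | n+1, f => pdR j (pdIter j n f)

/-- Multi-index partial derivative `∂^α`. -/
def pdMulti {d : ℕ} (α : Fin d → ℕ) (f : Rd d → ℝ) : Rd d → ℝ :=
  (List.finRange d).foldr (fun j g => pdIter j (α j) g) f

/-- The finite set of multi-indices `α` with `|α| = q`. -/
def mIdx (d q : ℕ) : Finset (Fin d → ℕ) := Finset.Nat.antidiagonalTuple d q

/-- The magnetic field `B_{jk} = ∂_j A_k - ∂_k A_j`. -/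
def magB {d : ℕ} (A : Fin d → Rd d → ℝ) (j k : Fin d) : Rd d → ℝ :=
  fun x => pdR j (A k) x - pdR k (A j) x

/-- The quantity `m̌_q(x)`. -/
def mq {d p : ℕ} (A : Fin d → Rd d → ℝ) (U : Fin p → Rd d → ℝ) (V : Rd d → ℝ) :
    ℕ → Rd d → ℝ
  | 0, x => ∑ ℓ, |U ℓ x|
  | q+1, x =>
      (∑ ℓ, ∑ α ∈ mIdx d (q+1), |pdMulti α (U ℓ) x|)
      + (∑ jk ∈ Finset.univ.filter (fun jk : Fin d × Fin d => jk.1 < jk.2),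
          ∑ α ∈ mIdx d q, |pdMulti α (magB A jk.1 jk.2) x|)
      + ∑ α ∈ mIdx d q, |pdMulti α V x|

/-- The quantity `m̌ʳ(x) = 1 + ∑_{q=0}^r m̌_q(x)`. -/
def mr {d p : ℕ} (A : Fin d → Rd d → ℝ) (U : Fin p → Rd d → ℝ) (V : Rd d → ℝ)
    (r : ℕ) (x : Rd d) : ℝ :=
  1 + ∑ q ∈ Finset.range (r+1), mq A U V q x

/-- The magnetic derivative `X_j u = (D_{x_j} - A_j) u`, `D_{x_j} = -i ∂_{x_j}`. -/
def Xop {d : ℕ} (A : Fin d → Rd d → ℝ) (j : Fin d) (u : Rd d → ℂ) : Rd d → ℂ :=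
  fun x => -Complex.I * pdC j u x - (A j x : ℂ) * u x

/-- The potential `W = ∑_ℓ U_ℓ² + iV`. -/
def Wfun {d p : ℕ} (U : Fin p → Rd d → ℝ) (V : Rd d → ℝ) (x : Rd d) : ℂ :=
  ((∑ ℓ, (U ℓ x)^2 : ℝ) : ℂ) + (V x : ℝ) * Complex.I

/-- The operator `P_{A,W} u = ∑_j X_j² u + W u` with `W = ∑_ℓ U_ℓ² + iV`. -/
def Pop {d p : ℕ} (A : Fin d → Rd d → ℝ) (U : Fin p → Rd d → ℝ) (V : Rd d → ℝ)
    (u : Rd d → ℂ) : Rd d → ℂ :=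
  fun x => (∑ j, Xop A j (Xop A j u) x) + Wfun U V x * u x

/-- The function `Φ(x,t)`. -/
def Phi {d p : ℕ} (A : Fin d → Rd d → ℝ) (U : Fin p → Rd d → ℝ) (V : Rd d → ℝ)
    (r : ℕ) (x : Rd d) (t : ℝ) : ℝ :=
  (∑ ℓ, ∑ q ∈ Finset.range (r+1), t^(q+1) * ∑ α ∈ mIdx d q, |pdMulti α (U ℓ) x|)
  + (∑ jk ∈ Finset.univ.filter (fun jk : Fin d × Fin d => jk.1 < jk.2),
      ∑ q ∈ Finset.range r, t^(q+2) * ∑ α ∈ mIdx d q, |pdMulti α (magB A jk.1 jk.2) x|)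
  + ∑ q ∈ Finset.range r, t^(q+2) * ∑ α ∈ mIdx d q, |pdMulti α V x|

/-- `R(x,μ) = sup { t ∈ [0,1] : Φ(x,t) ≤ μ }`. -/
def Rfun {d p : ℕ} (A : Fin d → Rd d → ℝ) (U : Fin p → Rd d → ℝ) (V : Rd d → ℝ)
    (r : ℕ) (x : Rd d) (μ : ℝ) : ℝ :=
  sSup {t : ℝ | t ∈ Set.Icc (0:ℝ) 1 ∧ Phi A U V r x t ≤ μ}


/-! ### Derivatives -/

lemma smooth_pdR {d : ℕ} (j : Fin d) {f : Rd d → ℝ} (hf : ContDiff ℝ (⊤ : ℕ∞) f) :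
    ContDiff ℝ (⊤ : ℕ∞) (pdR j f) := by
  have h : ContDiff ℝ (⊤ : ℕ∞) (fderiv ℝ f) := hf.fderiv_right (by simp)
  exact h.clm_apply contDiff_const

lemma smooth_pdIter {d : ℕ} (j : Fin d) (n : ℕ) {f : Rd d → ℝ} (hf : ContDiff ℝ (⊤ : ℕ∞) f) :
    ContDiff ℝ (⊤ : ℕ∞) (pdIter j n f) := by
  induction n with
  | zero => exact hf
  | succ n ih => exact smooth_pdR j ih

lemma smooth_fold {d : ℕ} (α : Fin d → ℕ) (l : List (Fin d)) {f : Rd d → ℝ}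
    (hf : ContDiff ℝ (⊤ : ℕ∞) f) :
    ContDiff ℝ (⊤ : ℕ∞) (l.foldr (fun j g => pdIter j (α j) g) f) := by
  induction l with
  | nil => exact hf
  | cons a l ih => exact smooth_pdIter a _ ih

lemma smooth_pdMulti {d : ℕ} (α : Fin d → ℕ) {f : Rd d → ℝ}
    (hf : ContDiff ℝ (⊤ : ℕ∞) f) : ContDiff ℝ (⊤ : ℕ∞) (pdMulti α f) :=
  smooth_fold α _ hf

lemma norm_pdR {d : ℕ} (j : Fin d) {f : Rd d → ℝ} (hf : ContDiff ℝ (⊤ : ℕ∞) f) (n : ℕ) (x : Rd d) :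
    ‖iteratedFDeriv ℝ n (pdR j f) x‖ ≤ ‖iteratedFDeriv ℝ (n+1) f x‖ := by
  have h : ContDiff ℝ (⊤ : ℕ∞) (fderiv ℝ f) := hf.fderiv_right (by simp)
  have := norm_iteratedFDeriv_clm_apply_const (𝕜 := ℝ) (n := n) (f := fderiv ℝ f)
    (c := EuclideanSpace.single j (1:ℝ)) (x := x) h.contDiffAt (by exact_mod_cast le_top)
  rw [norm_iteratedFDeriv_fderiv] at this
  rw [PiLp.norm_single, norm_one, one_mul] at this
  exact this

lemma norm_pdIter {d : ℕ} (j : Fin d) {f : Rd d → ℝ} (hf : ContDiff ℝ (⊤ : ℕ∞) f) (m n : ℕ)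
    (x : Rd d) :
    ‖iteratedFDeriv ℝ n (pdIter j m f) x‖ ≤ ‖iteratedFDeriv ℝ (n+m) f x‖ := by
  induction m generalizing n with
  | zero => exact le_rfl
  | succ m ih =>
    refine (norm_pdR j (smooth_pdIter j m hf) n x).trans ((ih (n+1)).trans (le_of_eq ?_))
    rw [show n + 1 + m = n + (m+1) by ring]

lemma norm_fold {d : ℕ} (α : Fin d → ℕ) (l : List (Fin d)) {f : Rd d → ℝ}
    (hf : ContDiff ℝ (⊤ : ℕ∞) f) (n : ℕ) (x : Rd d) :
    ‖iteratedFDeriv ℝ n (l.foldr (fun j g => pdIter j (α j) g) f) x‖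
      ≤ ‖iteratedFDeriv ℝ (n + (l.map α).sum) f x‖ := by
  induction l generalizing n with
  | nil => exact le_rfl
  | cons a l ih =>
    refine (norm_pdIter a (smooth_fold α l hf) (α a) n x).trans ((ih _).trans (le_of_eq ?_))
    rw [show n + α a + (l.map α).sum = n + ((a :: l).map α).sum by
      simp [add_assoc]]

lemma abs_pdMulti_le {d : ℕ} (α : Fin d → ℕ) {f : Rd d → ℝ}
    (hf : ContDiff ℝ (⊤ : ℕ∞) f) (x : Rd d) :
    |pdMulti α f x| ≤ ‖iteratedFDeriv ℝ (∑ i, α i) f x‖ := by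
  have := norm_fold α (List.finRange d) hf 0 x
  rw [norm_iteratedFDeriv_zero] at this
  have h2 : 0 + ((List.finRange d).map α).sum = ∑ i, α i := by
    rw [zero_add, ← List.ofFn_eq_map, List.sum_ofFn]
  rw [h2] at this
  exact this

lemma pdR_comm {d : ℕ} (i j : Fin d) {f : Rd d → ℝ} (hf : ContDiff ℝ (⊤ : ℕ∞) f) :
    pdR i (pdR j f) = pdR j (pdR i f) := by
  funext x
  have h : ContDiff ℝ (⊤ : ℕ∞) (fderiv ℝ f) := hf.fderiv_right (by simp)
  have hd : DifferentiableAt ℝ (fderiv ℝ f) x := (h.differentiable (by simp)) x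
  have key : ∀ v w : Rd d, fderiv ℝ (fun y => fderiv ℝ f y v) x w
      = fderiv ℝ (fderiv ℝ f) x w v := by
    intro v w
    rw [fderiv_clm_apply hd (differentiableAt_const v)]
    simp
  have hs : IsSymmSndFDerivAt ℝ f x :=
    hf.contDiffAt.isSymmSndFDerivAt (by
      rw [minSmoothness_of_isRCLikeNormedField]
      exact WithTop.coe_le_coe.2 (le_top : (2:ℕ∞) ≤ ⊤))
  unfold pdR
  rw [key, key]
  exact hs _ _

lemma pdR_pdIter {d : ℕ} (i j : Fin d) (n : ℕ) {f : Rd d → ℝ} (hf : ContDiff ℝ (⊤ : ℕ∞) f) :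
    pdR i (pdIter j n f) = pdIter j n (pdR i f) := by
  induction n with
  | zero => rfl
  | succ n ih =>
    change pdR i (pdR j (pdIter j n f)) = pdR j (pdIter j n (pdR i f))
    rw [pdR_comm i j (smooth_pdIter j n hf), ih]

lemma fold_congr {d : ℕ} (α β : Fin d → ℕ) (l : List (Fin d)) (h : ∀ j ∈ l, α j = β j)
    (f : Rd d → ℝ) :
    l.foldr (fun j g => pdIter j (α j) g) f = l.foldr (fun j g => pdIter j (β j) g) f := by
  induction l with
  | nil => rfl
  | cons a l ih =>
    simp only [List.foldr_cons]
    rw [ih (fun j hj => h j (List.mem_cons_of_mem _ hj)), h a List.mem_cons_self]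

lemma pdR_fold {d : ℕ} (α : Fin d → ℕ) (i : Fin d) (l : List (Fin d)) (hl : l.Nodup) (hi : i ∈ l)
    {f : Rd d → ℝ} (hf : ContDiff ℝ (⊤ : ℕ∞) f) :
    pdR i (l.foldr (fun j g => pdIter j (α j) g) f)
      = l.foldr (fun j g => pdIter j (Function.update α i (α i + 1) j) g) f := by
  induction l with
  | nil => simp at hi
  | cons a l ih =>
    simp only [List.foldr_cons]
    rw [List.nodup_cons] at hl
    by_cases hia : i = a
    · subst hia
      rw [fold_congr (Function.update α i (α i + 1)) α l]
      · simp only [Function.update_self]; rfl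
      · intro j hj
        rw [Function.update_of_ne]
        rintro rfl
        exact hl.1 hj
    · have hil : i ∈ l := by
        rcases List.mem_cons.1 hi with h | h
        · exact absurd h hia
        · exact h
      rw [pdR_pdIter i a _ (smooth_fold α l hf), ih hl.2 hil, Function.update_of_ne (Ne.symm hia)]

lemma pdR_pdMulti {d : ℕ} (α : Fin d → ℕ) (i : Fin d)
    {f : Rd d → ℝ} (hf : ContDiff ℝ (⊤ : ℕ∞) f) :
    pdR i (pdMulti α f) = pdMulti (Function.update α i (α i + 1)) f :=
  pdR_fold α i _ (List.nodup_finRange d) (List.mem_finRange i) hf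

lemma mIdx_update {d q : ℕ} {α : Fin d → ℕ} (h : α ∈ mIdx d q) (i : Fin d) :
    Function.update α i (α i + 1) ∈ mIdx d (q+1) := by
  unfold mIdx at *
  rw [Finset.Nat.mem_antidiagonalTuple] at *
  rw [Finset.sum_update_of_mem (Finset.mem_univ i), ← h,
    ← Finset.add_sum_erase _ _ (Finset.mem_univ i)]
  rw [Finset.sdiff_singleton_eq_erase]
  ring

lemma norm_fderiv_le {d : ℕ} (f : Rd d → ℝ) (x : Rd d) :
    ‖fderiv ℝ f x‖ ≤ ∑ j, |pdR j f x| := by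
  refine ContinuousLinearMap.opNorm_le_bound _ (Finset.sum_nonneg fun _ _ => abs_nonneg _) ?_
  intro v
  have hv : v = ∑ j, v j • EuclideanSpace.single j (1:ℝ) := by
    ext k
    simp [Finset.sum_apply, Pi.single_apply]
  conv_lhs => rw [hv, map_sum]
  refine (norm_sum_le _ _).trans ?_
  rw [Finset.sum_mul]
  refine Finset.sum_le_sum fun j _ => ?_
  rw [map_smul, norm_smul, mul_comm]
  exact mul_le_mul_of_nonneg_left (PiLp.norm_apply_le v j) (abs_nonneg _)

/-- The gradient of `∂^α f` is bounded through derivatives of one order higher. -/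
lemma norm_fderiv_pdMulti_le {d q : ℕ} {α : Fin d → ℕ} (h : α ∈ mIdx d q)
    {f : Rd d → ℝ} (hf : ContDiff ℝ (⊤ : ℕ∞) f) (x : Rd d) :
    ‖fderiv ℝ (pdMulti α f) x‖ ≤ d * ∑ β ∈ mIdx d (q+1), |pdMulti β f x| := by
  refine (norm_fderiv_le _ x).trans ?_
  have : ∀ j ∈ (Finset.univ : Finset (Fin d)),
      |pdR j (pdMulti α f) x| ≤ ∑ β ∈ mIdx d (q+1), |pdMulti β f x| := by
    intro j _
    rw [pdR_pdMulti α j hf]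
    exact Finset.single_le_sum (f := fun β => |pdMulti β f x|)
      (fun _ _ => abs_nonneg _) (mIdx_update h j)
  refine (Finset.sum_le_sum this).trans ?_
  simp

/-! ### Slow variation of `R` -/

/-- Sum of the absolute values of the derivatives of order `q`. -/
def sumD {d : ℕ} (q : ℕ) (f : Rd d → ℝ) (x : Rd d) : ℝ := ∑ α ∈ mIdx d q, |pdMulti α f x|

lemma sumD_nonneg {d : ℕ} (q : ℕ) (f : Rd d → ℝ) (x : Rd d) : 0 ≤ sumD q f x :=
  Finset.sum_nonneg fun _ _ => abs_nonneg _

lemma continuous_sumD {d : ℕ} (q : ℕ) {f : Rd d → ℝ} (hf : ContDiff ℝ (⊤ : ℕ∞) f) :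
    Continuous (sumD q f) :=
  continuous_finsetSum _ fun α _ => (smooth_pdMulti α hf).continuous.abs

lemma sumD_lip {d : ℕ} (q : ℕ) {f : Rd d → ℝ} (hf : ContDiff ℝ (⊤ : ℕ∞) f) {X : Set (Rd d)}
    (hX : Convex ℝ X) {x y : Rd d} (hx : x ∈ X) (hy : y ∈ X) {M : ℝ}
    (hM : ∀ z ∈ X, sumD (q+1) f z ≤ M) :
    sumD q f y ≤ sumD q f x + (mIdx d q).card * (d * M * ‖y - x‖) := by
  unfold sumD
  rw [← nsmul_eq_mul, ← Finset.sum_const, ← Finset.sum_add_distrib]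
  refine Finset.sum_le_sum fun α hα => ?_
  have h := hX.norm_image_sub_le_of_norm_fderiv_le (𝕜 := ℝ) (f := pdMulti α f) (C := d * M)
    (fun z _ => ((smooth_pdMulti α hf).differentiable (by simp)) z)
    (fun z hz => (norm_fderiv_pdMulti_le hα hf z).trans
      (mul_le_mul_of_nonneg_left (hM z hz) (Nat.cast_nonneg d))) hx hy
  rw [Real.norm_eq_abs] at h
  have := abs_sub_abs_le_abs_sub (pdMulti α f y) (pdMulti α f x)
  linarith

lemma fold_zero {d : ℕ} (l : List (Fin d)) (f : Rd d → ℝ) :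
    l.foldr (fun j g => pdIter j ((0 : Fin d → ℕ) j) g) f = f := by
  induction l with
  | nil => rfl
  | cons a l ih => rw [List.foldr_cons, ih]; rfl

lemma sumD_zero {d : ℕ} (f : Rd d → ℝ) (x : Rd d) : sumD 0 f x = |f x| := by
  unfold sumD mIdx
  rw [Finset.Nat.antidiagonalTuple_zero_right, Finset.sum_singleton]
  unfold pdMulti
  rw [fold_zero]

lemma smooth_magB {d : ℕ} {A : Fin d → Rd d → ℝ} (hA : ∀ j, ContDiff ℝ (⊤ : ℕ∞) (A j))
    (j k : Fin d) : ContDiff ℝ (⊤ : ℕ∞) (magB A j k) :=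
  (smooth_pdR j (hA k)).sub (smooth_pdR k (hA j))

/-- The part of `mq` coming from `B` and `V`. -/
def bvq {d : ℕ} (A : Fin d → Rd d → ℝ) (V : Rd d → ℝ) : ℕ → Rd d → ℝ
  | 0, _ => 0
  | q+1, x =>
      (∑ jk ∈ Finset.univ.filter (fun jk : Fin d × Fin d => jk.1 < jk.2),
          sumD q (magB A jk.1 jk.2) x)
      + sumD q V x

lemma mq_eq {d p : ℕ} (A : Fin d → Rd d → ℝ) (U : Fin p → Rd d → ℝ) (V : Rd d → ℝ) (q : ℕ)
    (x : Rd d) : mq A U V q x = (∑ ℓ, sumD q (U ℓ) x) + bvq A V q x := by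
  cases q with
  | zero =>
    unfold mq bvq
    simp only [sumD_zero, add_zero]
  | succ q =>
    unfold mq bvq sumD
    ring

lemma bvq_nonneg {d : ℕ} (A : Fin d → Rd d → ℝ) (V : Rd d → ℝ) (q : ℕ) (x : Rd d) :
    0 ≤ bvq A V q x := by
  cases q with
  | zero => exact le_rfl
  | succ q =>
    exact add_nonneg (Finset.sum_nonneg fun _ _ => sumD_nonneg _ _ _) (sumD_nonneg _ _ _)

lemma mq_nonneg {d p : ℕ} (A : Fin d → Rd d → ℝ) (U : Fin p → Rd d → ℝ) (V : Rd d → ℝ) (q : ℕ)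
    (x : Rd d) : 0 ≤ mq A U V q x := by
  rw [mq_eq]
  exact add_nonneg (Finset.sum_nonneg fun _ _ => sumD_nonneg _ _ _) (bvq_nonneg _ _ _ _)

lemma continuous_mq {d p : ℕ} {A : Fin d → Rd d → ℝ} {U : Fin p → Rd d → ℝ} {V : Rd d → ℝ}
    (hA : ∀ j, ContDiff ℝ (⊤ : ℕ∞) (A j)) (hU : ∀ ℓ, ContDiff ℝ (⊤ : ℕ∞) (U ℓ))
    (hV : ContDiff ℝ (⊤ : ℕ∞) V) (q : ℕ) : Continuous (mq A U V q) := by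
  have : mq A U V q = fun x => (∑ ℓ, sumD q (U ℓ) x) + bvq A V q x := funext (mq_eq A U V q)
  rw [this]
  refine (continuous_finsetSum _ fun ℓ _ => continuous_sumD q (hU ℓ)).add ?_
  cases q with
  | zero => exact continuous_const
  | succ q =>
    exact (continuous_finsetSum _ fun jk _ => continuous_sumD q (smooth_magB hA _ _)).add
      (continuous_sumD q hV)

lemma sumD_U_le {d p : ℕ} (A : Fin d → Rd d → ℝ) (U : Fin p → Rd d → ℝ) (V : Rd d → ℝ) (q : ℕ)
    (x : Rd d) (ℓ : Fin p) : sumD q (U ℓ) x ≤ mq A U V q x := by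
  rw [mq_eq]
  have h1 := Finset.single_le_sum (f := fun ℓ => sumD q (U ℓ) x)
    (fun _ _ => sumD_nonneg _ _ _) (Finset.mem_univ ℓ)
  have h2 := bvq_nonneg A V q x
  linarith

lemma bvq_le {d p : ℕ} (A : Fin d → Rd d → ℝ) (U : Fin p → Rd d → ℝ) (V : Rd d → ℝ) (q : ℕ)
    (x : Rd d) : bvq A V q x ≤ mq A U V q x := by
  rw [mq_eq]
  have h1 : 0 ≤ ∑ ℓ, sumD q (U ℓ) x := Finset.sum_nonneg fun _ _ => sumD_nonneg _ _ _
  linarith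

lemma bvq_lip {d : ℕ} {A : Fin d → Rd d → ℝ} {V : Rd d → ℝ}
    (hA : ∀ j, ContDiff ℝ (⊤ : ℕ∞) (A j)) (hV : ContDiff ℝ (⊤ : ℕ∞) V) (q : ℕ) :
    ∃ D : ℝ, 0 ≤ D ∧ ∀ X : Set (Rd d), Convex ℝ X → ∀ x ∈ X, ∀ y ∈ X, ∀ M : ℝ,
      (∀ z ∈ X, bvq A V (q+1) z ≤ M) → bvq A V q y ≤ bvq A V q x + D * M * ‖y - x‖ := by
  cases q with
  | zero => exact ⟨0, le_rfl, fun X _ x _ y _ M _ => by simp [bvq]⟩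
  | succ q =>
    refine ⟨(Finset.univ.filter (fun jk : Fin d × Fin d => jk.1 < jk.2)).card *
      ((mIdx d q).card * d) + (mIdx d q).card * d, by positivity, ?_⟩
    intro X hX x hx y hy M hM
    have hV' : ∀ z ∈ X, sumD (q+1) V z ≤ M := by
      intro z hz
      refine le_trans ?_ (hM z hz)
      have : 0 ≤ ∑ jk ∈ Finset.univ.filter (fun jk : Fin d × Fin d => jk.1 < jk.2),
          sumD (q+1) (magB A jk.1 jk.2) z := Finset.sum_nonneg fun _ _ => sumD_nonneg _ _ _
      simp only [bvq]
      linarith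
    have hB' : ∀ jk ∈ Finset.univ.filter (fun jk : Fin d × Fin d => jk.1 < jk.2),
        ∀ z ∈ X, sumD (q+1) (magB A jk.1 jk.2) z ≤ M := by
      intro jk hjk z hz
      refine le_trans ?_ (hM z hz)
      have h1 := Finset.single_le_sum (f := fun jk : Fin d × Fin d =>
        sumD (q+1) (magB A jk.1 jk.2) z) (fun _ _ => sumD_nonneg _ _ _) hjk
      have h2 := sumD_nonneg (q+1) V z
      simp only [bvq]
      linarith
    have h1 := sumD_lip q hV hX hx hy hV'
    have h2 : ∑ jk ∈ Finset.univ.filter (fun jk : Fin d × Fin d => jk.1 < jk.2),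
          sumD q (magB A jk.1 jk.2) y
        ≤ ∑ jk ∈ Finset.univ.filter (fun jk : Fin d × Fin d => jk.1 < jk.2),
          (sumD q (magB A jk.1 jk.2) x + (mIdx d q).card * (d * M * ‖y - x‖)) :=
      Finset.sum_le_sum fun jk hjk => sumD_lip q (smooth_magB hA jk.1 jk.2) hX hx hy (hB' jk hjk)
    rw [Finset.sum_add_distrib, Finset.sum_const, nsmul_eq_mul] at h2
    simp only [bvq]
    linarith

lemma mq_lip {d p : ℕ} {A : Fin d → Rd d → ℝ} {U : Fin p → Rd d → ℝ} {V : Rd d → ℝ}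
    (hA : ∀ j, ContDiff ℝ (⊤ : ℕ∞) (A j)) (hU : ∀ ℓ, ContDiff ℝ (⊤ : ℕ∞) (U ℓ))
    (hV : ContDiff ℝ (⊤ : ℕ∞) V) (q : ℕ) :
    ∃ D : ℝ, 0 ≤ D ∧ ∀ X : Set (Rd d), Convex ℝ X → ∀ x ∈ X, ∀ y ∈ X, ∀ M : ℝ,
      (∀ z ∈ X, mq A U V (q+1) z ≤ M) → mq A U V q y ≤ mq A U V q x + D * M * ‖y - x‖ := by
  obtain ⟨D, hD, h⟩ := bvq_lip hA hV q
  refine ⟨p * ((mIdx d q).card * d) + D, by positivity, ?_⟩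
  intro X hX x hx y hy M hM
  have h1 := h X hX x hx y hy M (fun z hz => (bvq_le A U V _ z).trans (hM z hz))
  have h2 := Finset.sum_le_sum fun ℓ (_ : ℓ ∈ (Finset.univ : Finset (Fin p))) =>
    sumD_lip q (hU ℓ) hX hx hy (fun z hz => (sumD_U_le A U V _ z ℓ).trans (hM z hz))
  rw [Finset.sum_add_distrib, Finset.sum_const, nsmul_eq_mul, Finset.card_univ,
    Fintype.card_fin] at h2
  rw [mq_eq, mq_eq]
  linarith

lemma Phi_eq {d p : ℕ} (A : Fin d → Rd d → ℝ) (U : Fin p → Rd d → ℝ) (V : Rd d → ℝ) (r : ℕ)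
    (x : Rd d) (t : ℝ) :
    Phi A U V r x t = ∑ q ∈ Finset.range (r+1), t^(q+1) * mq A U V q x := by
  have h1 : ∀ q, t^(q+1) * mq A U V q x
      = (∑ ℓ, t^(q+1) * sumD q (U ℓ) x) + t^(q+1) * bvq A V q x := by
    intro q
    rw [mq_eq, mul_add, Finset.mul_sum]
  rw [Finset.sum_congr rfl fun q _ => h1 q, Finset.sum_add_distrib,
    Finset.sum_range_succ' (fun q => t^(q+1) * bvq A V q x)]
  have h2 : ∀ q, t^(q+1+1) * bvq A V (q+1) x
      = (∑ jk ∈ Finset.univ.filter (fun jk : Fin d × Fin d => jk.1 < jk.2),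
          t^(q+2) * sumD q (magB A jk.1 jk.2) x) + t^(q+2) * sumD q V x := by
    intro q
    simp only [bvq]
    rw [mul_add, Finset.mul_sum]
  rw [Finset.sum_congr rfl fun q _ => h2 q, Finset.sum_add_distrib]
  simp only [bvq, mul_zero, add_zero]
  rw [← add_assoc]
  refine congrArg₂ _ (congrArg₂ _ ?_ ?_) rfl
  · exact Finset.sum_comm
  · exact Finset.sum_comm

lemma Phi_scale {d p : ℕ} (A : Fin d → Rd d → ℝ) (U : Fin p → Rd d → ℝ) (V : Rd d → ℝ) (r : ℕ)
    (x : Rd d) {t s : ℝ} (ht : 0 ≤ t) (hs : 0 ≤ s) (hs1 : s ≤ 1) :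
    Phi A U V r x (s * t) ≤ s * Phi A U V r x t := by
  rw [Phi_eq, Phi_eq, Finset.mul_sum]
  refine Finset.sum_le_sum fun q _ => ?_
  rw [mul_pow, ← mul_assoc]
  refine mul_le_mul_of_nonneg_right (mul_le_mul_of_nonneg_right ?_ (by positivity))
    (mq_nonneg A U V q x)
  exact pow_le_of_le_one hs hs1 (by simp)

lemma Phi_nonneg {d p : ℕ} (A : Fin d → Rd d → ℝ) (U : Fin p → Rd d → ℝ) (V : Rd d → ℝ) (r : ℕ)
    (x : Rd d) {t : ℝ} (ht : 0 ≤ t) : 0 ≤ Phi A U V r x t := by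
  rw [Phi_eq]
  exact Finset.sum_nonneg fun q _ => mul_nonneg (by positivity) (mq_nonneg A U V q x)

lemma bdd_R {d p : ℕ} (A : Fin d → Rd d → ℝ) (U : Fin p → Rd d → ℝ) (V : Rd d → ℝ) (r : ℕ)
    (x : Rd d) (μ : ℝ) : BddAbove {t : ℝ | t ∈ Set.Icc (0:ℝ) 1 ∧ Phi A U V r x t ≤ μ} :=
  ⟨1, fun _ ht => ht.1.2⟩

lemma le_R {d p : ℕ} (A : Fin d → Rd d → ℝ) (U : Fin p → Rd d → ℝ) (V : Rd d → ℝ) (r : ℕ)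
    (x : Rd d) (μ : ℝ) {t : ℝ} (h0 : 0 ≤ t) (h1 : t ≤ 1) (h : Phi A U V r x t ≤ μ) :
    t ≤ Rfun A U V r x μ :=
  le_csSup (bdd_R A U V r x μ) ⟨⟨h0, h1⟩, h⟩

lemma R_pos {d p : ℕ} (A : Fin d → Rd d → ℝ) (U : Fin p → Rd d → ℝ) (V : Rd d → ℝ) (r : ℕ)
    (x : Rd d) (μ : ℝ) (hμ : 1 ≤ μ) : 0 < Rfun A U V r x μ := by
  have hP := Phi_nonneg A U V r x (zero_le_one' ℝ)
  set s := (1 + Phi A U V r x 1)⁻¹ with hs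
  have hs0 : 0 < s := by positivity
  have hs1 : s ≤ 1 := inv_le_one_of_one_le₀ (by linarith)
  refine lt_of_lt_of_le hs0 (le_R A U V r x μ hs0.le hs1 ?_)
  have h := Phi_scale A U V r x (zero_le_one' ℝ) hs0.le hs1
  rw [mul_one] at h
  refine h.trans (le_trans ?_ hμ)
  rw [hs, inv_mul_le_iff₀ (by positivity)]
  linarith

lemma R_le_one {d p : ℕ} (A : Fin d → Rd d → ℝ) (U : Fin p → Rd d → ℝ) (V : Rd d → ℝ) (r : ℕ)
    (x : Rd d) (μ : ℝ) (hμ : 1 ≤ μ) : Rfun A U V r x μ ≤ 1 := by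
  refine csSup_le ⟨0, ⟨le_rfl, zero_le_one⟩, ?_⟩ fun _ ht => ht.1.2
  rw [Phi_eq]
  simp
  linarith

lemma Phi_slow {d p r : ℕ} {A : Fin d → Rd d → ℝ} {U : Fin p → Rd d → ℝ} {V : Rd d → ℝ}
    (hA : ∀ j, ContDiff ℝ (⊤ : ℕ∞) (A j)) (hU : ∀ ℓ, ContDiff ℝ (⊤ : ℕ∞) (U ℓ))
    (hV : ContDiff ℝ (⊤ : ℕ∞) V) {C₀ : ℝ} (hC₀ : 0 < C₀)
    (hT : ∀ x, mq A U V (r+1) x ≤ C₀ * mr A U V r x) :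
    ∃ c : ℝ, 0 < c ∧ c ≤ 1 ∧ ∀ μ : ℝ, 1 ≤ μ → ∀ t : ℝ, 0 < t → t ≤ 1 → ∀ x y : Rd d,
      Phi A U V r x t ≤ μ → dist x y ≤ c * t → Phi A U V r y t ≤ 2 * μ := by
  choose D hD hlip using fun q => mq_lip hA hU hV q
  set C1 := max 1 C₀ with hC1
  have hC1' : 1 ≤ C1 := le_max_left _ _
  set E := ∑ q ∈ Finset.range (r+1), D q with hE
  have hE0 : 0 ≤ E := Finset.sum_nonneg fun q _ => hD q
  set c := (4 * (1 + E * C1))⁻¹ with hc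
  have hEC : 0 ≤ E * C1 := by positivity
  have hc0 : 0 < c := by positivity
  have hcE : E * C1 * c ≤ 1/4 := by
    rw [hc, ← div_eq_mul_inv, div_le_iff₀ (by positivity)]
    linarith
  refine ⟨c, hc0, inv_le_one_of_one_le₀ (by linarith), ?_⟩
  intro μ hμ t ht ht1 x y hx hxy
  have hcont : Continuous fun z => Phi A U V r z t := by
    simp only [Phi_eq]
    exact continuous_finsetSum _ fun q _ => continuous_const.mul (continuous_mq hA hU hV q)
  obtain ⟨z, hz, hmax⟩ := (isCompact_closedBall x (c * t)).exists_isMaxOn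
    ⟨x, Metric.mem_closedBall_self (by positivity)⟩ hcont.continuousOn
  set M := Phi A U V r z t with hM
  have hM0 : 0 ≤ M := Phi_nonneg A U V r z ht.le
  have hle : ∀ w ∈ Metric.closedBall x (c * t), Phi A U V r w t ≤ M := fun w hw => hmax hw
  have hterm : ∀ w ∈ Metric.closedBall x (c * t), ∀ q ∈ Finset.range (r+1),
      t^(q+1) * mq A U V q w ≤ M := by
    intro w hw q hq
    refine le_trans ?_ (hle w hw)
    rw [Phi_eq]
    exact Finset.single_le_sum (f := fun q => t^(q+1) * mq A U V q w)
      (fun q _ => mul_nonneg (by positivity) (mq_nonneg A U V q w)) hq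
  have hnext : ∀ q ∈ Finset.range (r+1), ∀ w ∈ Metric.closedBall x (c * t),
      mq A U V (q+1) w ≤ C1 * (1 + M) / t^(q+2) := by
    intro q hq w hw
    rw [le_div_iff₀ (by positivity), mul_comm]
    by_cases hqr : q = r
    · subst hqr
      have h1 : t^(q+1) * mr A U V q w ≤ 1 + M := by
        unfold mr
        rw [mul_add, mul_one, Finset.mul_sum]
        have ha : t^(q+1) ≤ 1 := pow_le_one₀ ht.le ht1
        have hb : ∑ i ∈ Finset.range (q+1), t^(q+1) * mq A U V i w ≤ M := by
          refine le_trans ?_ (hle w hw)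
          rw [Phi_eq]
          refine Finset.sum_le_sum fun i hi => mul_le_mul_of_nonneg_right ?_ (mq_nonneg A U V i w)
          exact pow_le_pow_of_le_one ht.le ht1 (by have := Finset.mem_range.1 hi; omega)
        linarith
      calc t^(q+2) * mq A U V (q+1) w ≤ t^(q+1) * mq A U V (q+1) w :=
            mul_le_mul_of_nonneg_right (pow_le_pow_of_le_one ht.le ht1 (by omega))
              (mq_nonneg A U V _ w)
        _ ≤ t^(q+1) * (C₀ * mr A U V q w) := mul_le_mul_of_nonneg_left (hT w) (by positivity)
        _ = C₀ * (t^(q+1) * mr A U V q w) := by ring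
        _ ≤ C₀ * (1 + M) := mul_le_mul_of_nonneg_left h1 hC₀.le
        _ ≤ C1 * (1 + M) := mul_le_mul_of_nonneg_right (le_max_right _ _) (by linarith)
    · have h1 := hterm w hw (q+1) (by have := Finset.mem_range.1 hq; simp; omega)
      calc t^(q+2) * mq A U V (q+1) w ≤ M := h1
        _ ≤ 1 * (1 + M) := by linarith
        _ ≤ C1 * (1 + M) := mul_le_mul_of_nonneg_right hC1' (by linarith)
  have hstep : ∀ w ∈ Metric.closedBall x (c * t),
      Phi A U V r w t ≤ μ + (1 + M) / 4 := by
    intro w hw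
    have hwx : ‖w - x‖ ≤ c * t := by
      rw [← dist_eq_norm]; exact hw
    have h1 : Phi A U V r w t ≤ Phi A U V r x t + E * (C1 * (1 + M) * c) := by
      rw [Phi_eq, Phi_eq, hE, Finset.sum_mul, ← Finset.sum_add_distrib]
      refine Finset.sum_le_sum fun q hq => ?_
      have h2 := hlip q _ (convex_closedBall x (c * t)) x
        (Metric.mem_closedBall_self (by positivity)) w hw _ (hnext q hq)
      have h3 : D q * (C1 * (1 + M) / t^(q+2)) * ‖w - x‖
          ≤ D q * (C1 * (1 + M) / t^(q+2)) * (c * t) := by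
        refine mul_le_mul_of_nonneg_left hwx (mul_nonneg (hD q) ?_)
        positivity
      calc t^(q+1) * mq A U V q w
          ≤ t^(q+1) * (mq A U V q x + D q * (C1 * (1 + M) / t^(q+2)) * (c * t)) :=
            mul_le_mul_of_nonneg_left (by linarith) (by positivity)
        _ = t^(q+1) * mq A U V q x + D q * (C1 * (1 + M) * c) := by
            have : t ≠ 0 := ht.ne'
            field_simp
            ring
    have h4 : E * (C1 * (1 + M) * c) ≤ (1 + M) / 4 := by
      have := mul_le_mul_of_nonneg_right hcE (by linarith : (0:ℝ) ≤ 1 + M)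
      linarith
    linarith
  have h5 := hstep z hz
  have h6 := hle y (by rw [Metric.mem_closedBall, dist_comm]; exact hxy)
  linarith

lemma R_slow {d p r : ℕ} {A : Fin d → Rd d → ℝ} {U : Fin p → Rd d → ℝ} {V : Rd d → ℝ}
    (hA : ∀ j, ContDiff ℝ (⊤ : ℕ∞) (A j)) (hU : ∀ ℓ, ContDiff ℝ (⊤ : ℕ∞) (U ℓ))
    (hV : ContDiff ℝ (⊤ : ℕ∞) V) {C₀ : ℝ} (hC₀ : 0 < C₀)
    (hT : ∀ x, mq A U V (r+1) x ≤ C₀ * mr A U V r x) :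
    ∃ c : ℝ, 0 < c ∧ c ≤ 1 ∧ ∀ μ : ℝ, 1 ≤ μ → ∀ x y : Rd d,
      dist x y ≤ c * Rfun A U V r x μ → Rfun A U V r x μ ≤ 4 * Rfun A U V r y μ := by
  obtain ⟨c, hc0, hc1, h⟩ := Phi_slow (r := r) hA hU hV hC₀ hT
  refine ⟨c / 2, by positivity, by linarith, ?_⟩
  intro μ hμ x y hxy
  have hR := R_pos A U V r x μ hμ
  have hlt : Rfun A U V r x μ / 2 < Rfun A U V r x μ := by linarith
  obtain ⟨t, ht, htR⟩ := exists_lt_of_lt_csSup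
    (s := {t : ℝ | t ∈ Set.Icc (0:ℝ) 1 ∧ Phi A U V r x t ≤ μ})
    (by by_contra hne
        rw [Set.not_nonempty_iff_eq_empty] at hne
        unfold Rfun at hR
        rw [hne, Real.sSup_empty] at hR
        exact lt_irrefl _ hR) hlt
  have ht0 : 0 < t := by linarith
  have h1 := h μ hμ t ht0 ht.1.2 x y ht.2 (by
    refine hxy.trans ?_
    have := mul_le_mul_of_nonneg_left htR.le hc0.le
    linarith)
  have h2 := Phi_scale A U V r y ht0.le (by norm_num : (0:ℝ) ≤ 1/2) (by norm_num)
  have h3 := le_R A U V r y μ (t := 1/2 * t) (by positivity) (by have := ht.1.2; linarith)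
    (by linarith)
  linarith

/-! ### Covering and partition of unity -/

lemma exists_cover {d : ℕ} (R : Rd d → ℝ) (hR0 : ∀ x, 0 < R x) (hR1 : ∀ x, R x ≤ 1)
    {ε : ℝ} (hε : 0 < ε) :
    ∃ (xs : ℕ → Rd d) (P : Set ℕ),
      (∀ i ∈ P, ∀ j ∈ P, i ≠ j → ε * R (xs i) ≤ dist (xs i) (xs j)) ∧
      ∀ x, ∃ i ∈ P, dist x (xs i) ≤ 5 * (ε * R (xs i)) := by
  obtain ⟨u, -, hdisj, hcov⟩ := Vitali.exists_disjoint_subfamily_covering_enlargement_closedBall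
    (Set.univ : Set (Rd d)) (fun x => x) (fun x => ε * R x) ε
    (fun a _ => by nlinarith [hR1 a]) 5 (by norm_num)
  have hcount : u.Countable := hdisj.countable_of_nonempty_interior fun a _ => by
    refine ⟨a, ?_⟩
    exact Metric.ball_subset_interior_closedBall
      (Metric.mem_ball_self (mul_pos hε (hR0 a)))
  have := hcount.to_subtype
  obtain ⟨e, he⟩ := exists_injective_nat u
  refine ⟨Function.extend e (fun a => (a : Rd d)) 0, Set.range e, ?_, ?_⟩
  · rintro _ ⟨a, rfl⟩ _ ⟨b, rfl⟩ hab
    rw [he.extend_apply, he.extend_apply]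
    have hne : (a : Rd d) ≠ b := fun h => hab (by rw [Subtype.ext h])
    have h := hdisj a.2 b.2 hne
    by_contra hlt
    push Not at hlt
    refine Set.disjoint_left.1 h (?_ : (b : Rd d) ∈ _) ?_
    · rw [Metric.mem_closedBall, dist_comm]; exact hlt.le
    · exact Metric.mem_closedBall_self (mul_pos hε (hR0 _)).le
  · intro x
    obtain ⟨b, hb, hsub⟩ := hcov x (Set.mem_univ x)
    refine ⟨e ⟨b, hb⟩, ⟨_, rfl⟩, ?_⟩
    rw [he.extend_apply]
    exact hsub (Metric.mem_closedBall_self (mul_pos hε (hR0 _)).le)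

lemma exists_card_bound (d : ℕ) (M : ℝ) {δ : ℝ} (hδ : 0 < δ) :
    ∃ N : ℕ, ∀ (xs : ℕ → Rd d) (x₀ : Rd d) (ρ : ℝ) (s : Finset ℕ), 0 < ρ →
      (∀ i ∈ s, dist (xs i) x₀ ≤ M * ρ) →
      (∀ i ∈ s, ∀ j ∈ s, i ≠ j → δ * ρ ≤ dist (xs i) (xs j)) → s.card ≤ N := by
  classical
  obtain ⟨t, -, htf, ht⟩ := (isCompact_closedBall (0 : Rd d) M).finite_cover_balls (half_pos hδ)
  refine ⟨htf.toFinset.card, ?_⟩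
  intro xs x₀ ρ s hρ hM hsep
  have hex : ∀ i ∈ s, ∃ c ∈ t, dist (ρ⁻¹ • (xs i - x₀)) c < δ / 2 := by
    intro i hi
    have hmem : ρ⁻¹ • (xs i - x₀) ∈ Metric.closedBall (0 : Rd d) M := by
      rw [mem_closedBall_zero_iff, norm_smul, norm_inv, Real.norm_of_nonneg hρ.le,
        ← dist_eq_norm, inv_mul_le_iff₀ hρ, mul_comm]
      exact hM i hi
    simpa using ht hmem
  choose! f hf hfd using hex
  refine Finset.card_le_card_of_injOn f (fun i hi => ?_) ?_
  · simpa using hf i hi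
  · intro i hi j hj hij
    by_contra hne
    have h1 := hfd i hi
    have h2 := hfd j hj
    rw [← hij] at h2
    have h3 := dist_triangle_right (ρ⁻¹ • (xs i - x₀)) (ρ⁻¹ • (xs j - x₀)) (f i)
    have h4 : dist (ρ⁻¹ • (xs i - x₀)) (ρ⁻¹ • (xs j - x₀)) = ρ⁻¹ * dist (xs i) (xs j) := by
      rw [dist_smul₀, dist_sub_right, norm_inv, Real.norm_of_nonneg hρ.le]
    have h5 := hsep i hi j hj hne
    have h6 : δ ≤ ρ⁻¹ * dist (xs i) (xs j) := by
      rw [le_inv_mul_iff₀ hρ]; linarith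
    linarith

lemma le_infty (n : ℕ) : (n : WithTop ℕ∞) ≤ ((⊤ : ℕ∞) : WithTop ℕ∞) := by
  exact_mod_cast le_top

/-- Leibniz convolution of bounds. -/
def convB (F G : ℕ → ℝ) (n : ℕ) : ℝ :=
  ∑ i ∈ Finset.range (n+1), (n.choose i : ℝ) * F i * G (n - i)

lemma mul_bd {d : ℕ} {f g : Rd d → ℝ} (hf : ContDiff ℝ (⊤ : ℕ∞) f) (hg : ContDiff ℝ (⊤ : ℕ∞) g)
    {x : Rd d} {ρ : ℝ} {F G : ℕ → ℝ}
    (hF : ∀ n, ‖iteratedFDeriv ℝ n f x‖ ≤ F n * ρ^n)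
    (hG : ∀ n, ‖iteratedFDeriv ℝ n g x‖ ≤ G n * ρ^n) (n : ℕ) :
    ‖iteratedFDeriv ℝ n (fun y => f y * g y) x‖ ≤ convB F G n * ρ^n := by
  refine (norm_iteratedFDeriv_mul_le hf hg x (le_infty n)).trans ?_
  unfold convB
  rw [Finset.sum_mul]
  refine Finset.sum_le_sum fun i hi => ?_
  have hi' : i ≤ n := by have := Finset.mem_range.1 hi; omega
  have h0 : 0 ≤ F i * ρ^i := (norm_nonneg _).trans (hF i)
  calc (n.choose i : ℝ) * ‖iteratedFDeriv ℝ i f x‖ * ‖iteratedFDeriv ℝ (n - i) g x‖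
      ≤ (n.choose i : ℝ) * (F i * ρ^i) * (G (n-i) * ρ^(n-i)) := by
        gcongr
        · exact hF i
        · exact hG (n-i)
    _ = (n.choose i : ℝ) * F i * G (n-i) * (ρ^i * ρ^(n-i)) := by ring
    _ = (n.choose i : ℝ) * F i * G (n-i) * ρ^n := by
        rw [← pow_add, Nat.add_sub_cancel' hi']

lemma comp_bd (d : ℕ) (N : ℝ) (BS : ℕ → ℝ) (hBS : ∀ n, 0 ≤ BS n) :
    ∃ BG : ℕ → ℝ, ∀ S : Rd d → ℝ, ContDiff ℝ (⊤ : ℕ∞) S → (∀ y, 0 < S y) →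
      ∀ (x : Rd d) (ρ : ℝ), 0 ≤ ρ → S x ∈ Set.Icc 1 N →
        (∀ n, ‖iteratedFDeriv ℝ n S x‖ ≤ BS n * ρ^n) →
        ∀ n, ‖iteratedFDeriv ℝ n (fun y => (√(S y))⁻¹) x‖ ≤ BG n * ρ^n := by
  have hg : ContDiffOn ℝ (⊤ : ℕ∞) (fun s : ℝ => (√s)⁻¹) (Set.Ioi 0) := by
    intro s hs
    have hs' : s ≠ 0 := ne_of_gt hs
    exact ((Real.contDiffAt_sqrt hs').inv (Real.sqrt_ne_zero'.2 hs)).contDiffWithinAt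
  have hu : UniqueDiffOn ℝ (Set.Ioi (0:ℝ)) := isOpen_Ioi.uniqueDiffOn
  have hb : ∀ i : ℕ, ∃ C : ℝ, ∀ s ∈ Set.Icc 1 N,
      ‖iteratedFDerivWithin ℝ i (fun s : ℝ => (√s)⁻¹) (Set.Ioi 0) s‖ ≤ C := by
    intro i
    refine isCompact_Icc.exists_bound_of_continuousOn ?_
    refine (hg.continuousOn_iteratedFDerivWithin (le_infty i) hu).mono ?_
    intro s hs
    exact lt_of_lt_of_le zero_lt_one hs.1
  choose C hC using hb
  refine ⟨fun n => n.factorial * (∑ i ∈ Finset.range (n+1), |C i|)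
    * (1 + ∑ i ∈ Finset.range (n+1), BS i)^n, ?_⟩
  intro S hS hpos x ρ hρ hx hbd n
  have h := norm_iteratedFDeriv_comp_le' (𝕜 := ℝ) (g := fun s : ℝ => (√s)⁻¹) (f := S) (n := n)
    (t := Set.Ioi 0) (by rintro _ ⟨y, rfl⟩; exact hpos y) hu hg hS (le_infty n) x
    (C := ∑ i ∈ Finset.range (n+1), |C i|)
    (D := (1 + ∑ i ∈ Finset.range (n+1), BS i) * ρ) ?_ ?_
  · rw [mul_pow, ← mul_assoc] at h
    exact h
  · intro i hi
    refine ((hC i _ hx).trans (le_abs_self _)).trans ?_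
    exact Finset.single_le_sum (f := fun i => |C i|) (fun _ _ => abs_nonneg _)
      (Finset.mem_range.2 (by omega))
  · intro i hi1 hi
    refine (hbd i).trans ?_
    rw [mul_pow]
    refine mul_le_mul_of_nonneg_right ?_ (by positivity)
    have h1 : BS i ≤ ∑ i ∈ Finset.range (n+1), BS i :=
      Finset.single_le_sum (f := BS) (fun _ _ => hBS _) (Finset.mem_range.2 (by omega))
    have h2 : 0 ≤ ∑ i ∈ Finset.range (n+1), BS i := Finset.sum_nonneg fun _ _ => hBS _
    have h3 : (1 + ∑ i ∈ Finset.range (n+1), BS i) ≤ (1 + ∑ i ∈ Finset.range (n+1), BS i)^i :=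
      le_self_pow₀ (by linarith) (by omega)
    linarith

lemma convB_nonneg {F G : ℕ → ℝ} (hF : ∀ n, 0 ≤ F n) (hG : ∀ n, 0 ≤ G n) (n : ℕ) :
    0 ≤ convB F G n :=
  Finset.sum_nonneg fun i _ => mul_nonneg (mul_nonneg (by positivity) (hF i)) (hG _)

lemma normalize_family (d N : ℕ) (Bψ : ℕ → ℝ) (hBψ : ∀ n, 0 ≤ Bψ n) :
    ∃ Bφ : ℕ → ℝ, ∀ (ρ : Rd d → ℝ) (F : Rd d → Finset ℕ) (ψ : ℕ → Rd d → ℝ),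
      (∀ x, 0 ≤ ρ x) → (∀ j, ContDiff ℝ (⊤ : ℕ∞) (ψ j)) → (∀ j x, |ψ j x| ≤ 1) →
      (∀ x, (F x).card ≤ N) → (∀ x, ∀ᶠ y in nhds x, ∀ j, j ∉ F x → ψ j y = 0) →
      (∀ x, ∀ j ∈ F x, ∀ n, ‖iteratedFDeriv ℝ n (ψ j) x‖ ≤ Bψ n * ρ x ^ n) →
      (∀ x, ∃ j, ψ j x = 1) →
      ∃ g : Rd d → ℝ, ContDiff ℝ (⊤ : ℕ∞) g ∧ (∀ x, ∑' j, (ψ j x * g x)^2 = 1) ∧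
        ∀ x, ∀ j ∈ F x, ∀ n, ‖iteratedFDeriv ℝ n (fun y => ψ j y * g y) x‖ ≤ Bφ n * ρ x ^ n := by
  obtain ⟨BG, hBG⟩ := comp_bd d N (fun n => N * convB Bψ Bψ n)
    (fun n => mul_nonneg (Nat.cast_nonneg _) (convB_nonneg hBψ hBψ n))
  refine ⟨convB Bψ BG, ?_⟩
  intro ρ F ψ hρ hψ hψ1 hcard hloc hbd hone
  set S : Rd d → ℝ := fun y => ∑' j, ψ j y * ψ j y with hS
  have hSx : ∀ x, ∀ᶠ y in nhds x, S y = ∑ j ∈ F x, ψ j y * ψ j y := by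
    intro x
    filter_upwards [hloc x] with y hy
    refine tsum_eq_sum fun j hj => ?_
    rw [hy j hj, mul_zero]
  have hsm : ∀ x, ContDiff ℝ (⊤ : ℕ∞) (fun y => ∑ j ∈ F x, ψ j y * ψ j y) := fun x =>
    ContDiff.sum fun j _ => (hψ j).mul (hψ j)
  have hSsm : ContDiff ℝ (⊤ : ℕ∞) S := by
    rw [contDiff_iff_contDiffAt]
    intro x
    exact (hsm x).contDiffAt.congr_of_eventuallyEq (hSx x)
  have hSlow : ∀ x, 1 ≤ S x := by
    intro x
    obtain ⟨j, hj⟩ := hone x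
    have hjF : j ∈ F x := by
      by_contra hjF
      have := (hloc x).self_of_nhds j hjF
      rw [hj] at this
      exact one_ne_zero this
    rw [(hSx x).self_of_nhds]
    have := Finset.single_le_sum (f := fun j => ψ j x * ψ j x)
      (fun j _ => mul_self_nonneg _) hjF
    simp only [hj] at this
    linarith
  have hSup : ∀ x, S x ≤ N := by
    intro x
    rw [(hSx x).self_of_nhds]
    calc ∑ j ∈ F x, ψ j x * ψ j x ≤ ∑ j ∈ F x, (1:ℝ) := by
          refine Finset.sum_le_sum fun j _ => ?_
          rw [← abs_mul_abs_self]
          exact mul_le_one₀ (hψ1 j x) (abs_nonneg _) (hψ1 j x)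
      _ = (F x).card := by simp
      _ ≤ N := by exact_mod_cast hcard x
  have hSpos : ∀ x, 0 < S x := fun x => lt_of_lt_of_le one_pos (hSlow x)
  have hSbd : ∀ x n, ‖iteratedFDeriv ℝ n S x‖ ≤ (N * convB Bψ Bψ n) * ρ x ^ n := by
    intro x n
    have he : S =ᶠ[nhds x] fun y => ∑ j ∈ F x, ψ j y * ψ j y := hSx x
    rw [(he.iteratedFDeriv ℝ n).self_of_nhds]
    have hs' := iteratedFDeriv_fun_sum_apply (𝕜 := ℝ) (f := fun j y => ψ j y * ψ j y) (u := F x)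
      (n := n) (x := x) (fun j _ => (((hψ j).mul (hψ j)).of_le (le_infty n)).contDiffAt)
    rw [hs']
    refine (norm_sum_le _ _).trans ?_
    have hnn : 0 ≤ convB Bψ Bψ n * ρ x ^ n :=
      mul_nonneg (convB_nonneg hBψ hBψ n) (pow_nonneg (hρ x) n)
    calc ∑ j ∈ F x, ‖iteratedFDeriv ℝ n (fun y => ψ j y * ψ j y) x‖
        ≤ ∑ j ∈ F x, convB Bψ Bψ n * ρ x ^ n :=
          Finset.sum_le_sum fun j hj =>
            mul_bd (hψ j) (hψ j) (hbd x j hj) (hbd x j hj) n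
      _ = (F x).card * (convB Bψ Bψ n * ρ x ^ n) := by rw [Finset.sum_const, nsmul_eq_mul]
      _ ≤ N * (convB Bψ Bψ n * ρ x ^ n) :=
          mul_le_mul_of_nonneg_right (by exact_mod_cast hcard x) hnn
      _ = _ := by ring
  have hgsm : ContDiff ℝ (⊤ : ℕ∞) (fun y => (√(S y))⁻¹) :=
    (hSsm.sqrt fun x => (hSpos x).ne').inv fun x => Real.sqrt_ne_zero'.2 (hSpos x)
  refine ⟨fun y => (√(S y))⁻¹, hgsm, ?_, ?_⟩
  · intro x
    have h1 : ∀ j, (ψ j x * (√(S x))⁻¹)^2 = (ψ j x * ψ j x) * (S x)⁻¹ := by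
      intro j
      rw [mul_pow, inv_pow, Real.sq_sqrt (hSpos x).le]
      ring
    simp only [h1]
    rw [tsum_mul_right]
    exact mul_inv_cancel₀ (hSpos x).ne'
  · intro x j hj n
    exact mul_bd (hψ j) hgsm (hbd x j hj)
      (hBG S hSsm hSpos x (ρ x) (hρ x) ⟨hSlow x, hSup x⟩ (hSbd x)) n

lemma bump_scale {d : ℕ} {η : Rd d → ℝ} (hη : ContDiff ℝ (⊤ : ℕ∞) η) {B : ℕ → ℝ}
    (hB : ∀ n x, ‖iteratedFDeriv ℝ n η x‖ ≤ B n) {a : ℝ} (ha : 0 ≤ a) (x₀ x : Rd d) (n : ℕ) :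
    ‖iteratedFDeriv ℝ n (fun y => η (a • (y - x₀))) x‖ ≤ B n * a^n := by
  have h1 := iteratedFDeriv_comp_sub (𝕜 := ℝ) (f := fun z => η (a • z)) n x₀ x
  rw [h1, iteratedFDeriv_comp_const_smul a (hη.of_le (le_infty n)), norm_smul, norm_pow,
    Real.norm_of_nonneg ha, mul_comm]
  exact mul_le_mul_of_nonneg_right (hB n _) (by positivity)

theorem exists_partition (d : ℕ) {c K : ℝ} (hc0 : 0 < c) (hc1 : c ≤ 1) (hK : 1 ≤ K) :
    ∃ (Chat : (Fin d → ℕ) → ℝ) (Chat' : ℝ), (∀ α, 0 < Chat α) ∧ 0 < Chat' ∧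
      ∀ R : Rd d → ℝ, (∀ x, 0 < R x) → (∀ x, R x ≤ 1) →
        (∀ x y, dist x y ≤ c * R x → R x ≤ K * R y) →
        ∃ (φ : ℕ → Rd d → ℝ) (xs : ℕ → Rd d),
          (∀ j, ContDiff ℝ (⊤ : ℕ∞) (φ j) ∧ HasCompactSupport (φ j)) ∧
          (∀ x, ∑' j, (φ j x)^2 = 1) ∧
          (∀ j, tsupport (φ j) ⊆ Metric.ball (xs j) (R (xs j))) ∧
          (∀ α : Fin d → ℕ, ∀ x : Rd d,
            (∑' j, (pdMulti α (φ j) x)^2)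
              ≤ Chat α / (R x) ^ (2 * ∑ i, α i)) ∧
          (∀ k : ℕ, k = 1 ∨ k = 2 →
            ∀ u : Rd d → ℂ, ContDiff ℝ (⊤ : ℕ∞) u → HasCompactSupport u →
              (∫ x : Rd d, ‖u x‖^2 / (R x) ^ (2*k))
                ≤ Chat' * ∑' j, ∫ x : Rd d,
                    (φ j x)^2 * ‖u x‖^2 / (R (xs j)) ^ (2*k)) := by
  classical
  have hK0 : 0 < K := by linarith
  obtain ⟨c', hc'⟩ : ∃ c', c' = c / K := ⟨_, rfl⟩
  have hc'0 : 0 < c' := by rw [hc']; positivity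
  have hc'c : c' ≤ c := by rw [hc']; exact div_le_self hc0.le hK
  have hc'K : c' * K = c := by rw [hc']; field_simp
  -- the bump function
  let η : ContDiffBump (0 : Rd d) := ⟨1/2, 3/4, by norm_num, by norm_num⟩
  have hηsm : ContDiff ℝ (⊤ : ℕ∞) (η : Rd d → ℝ) := η.contDiff
  have hηB : ∀ n : ℕ, ∃ C : ℝ, ∀ x, ‖iteratedFDeriv ℝ n (η : Rd d → ℝ) x‖ ≤ C := fun n =>
    (hηsm.continuous_iteratedFDeriv (le_infty n)).bounded_above_of_compact_support
      (η.hasCompactSupport.iteratedFDeriv n)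
  choose B hB using hηB
  have hB0 : ∀ n, 0 ≤ B n := fun n => (norm_nonneg _).trans (hB n 0)
  obtain ⟨N, hN⟩ := exists_card_bound d (c' * (1 + K^2))
    (δ := c' / 10 / K^2) (by positivity)
  obtain ⟨Bφ, hBφ⟩ := normalize_family d N (fun n => B n * (K^2 / c')^n)
    (fun n => mul_nonneg (hB0 n) (by positivity))
  refine ⟨fun α => N * (Bφ (∑ i, α i))^2 + 1, K^4, fun α => by positivity, by positivity, ?_⟩
  intro R hR0 hR1 hslow
  have hslow2 : ∀ x y, dist x y ≤ c' * R x → R x ≤ K * R y ∧ R y ≤ K * R x := by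
    intro x y hxy
    have h1 : R x ≤ K * R y := hslow x y
      (hxy.trans (mul_le_mul_of_nonneg_right hc'c (hR0 x).le))
    refine ⟨h1, hslow y x ?_⟩
    rw [dist_comm]
    refine hxy.trans ?_
    rw [← hc'K, mul_assoc]
    exact mul_le_mul_of_nonneg_left h1 hc'0.le
  obtain ⟨xs, P, hsep, hcov⟩ := exists_cover R hR0 hR1 (ε := c' / 10) (by positivity)
  -- the unnormalized family
  let a : ℕ → ℝ := fun j => (c' * R (xs j))⁻¹
  have ha : ∀ j, 0 < a j := fun j => inv_pos.2 (mul_pos hc'0 (hR0 _))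
  let ψ : ℕ → Rd d → ℝ := fun j y => if j ∈ P then η (a j • (y - xs j)) else 0
  have hψP : ∀ j, j ∈ P → ψ j = fun y => η (a j • (y - xs j)) := fun j hj => by
    funext y; exact if_pos hj
  have hψn : ∀ j, j ∉ P → ψ j = fun y => 0 := fun j hj => by
    funext y; exact if_neg hj
  have hψsm : ∀ j, ContDiff ℝ (⊤ : ℕ∞) (ψ j) := by
    intro j
    by_cases hj : j ∈ P
    · rw [hψP j hj]
      have h1 : ContDiff ℝ (⊤ : ℕ∞) (fun y : Rd d => a j • (y - xs j)) := by fun_prop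
      exact hηsm.comp h1
    · rw [hψn j hj]; exact contDiff_const
  have hψ1 : ∀ j x, |ψ j x| ≤ 1 := by
    intro j x
    by_cases hj : j ∈ P
    · rw [hψP j hj]
      simp only
      rw [abs_of_nonneg η.nonneg]
      exact η.le_one
    · rw [hψn j hj]; simp
  have hnorm : ∀ j y, ‖a j • (y - xs j)‖ = dist y (xs j) / (c' * R (xs j)) := by
    intro j y
    rw [norm_smul, Real.norm_of_nonneg (ha j).le, dist_eq_norm, div_eq_inv_mul]
  have hcR : ∀ j, 0 < c' * R (xs j) := fun j => mul_pos hc'0 (hR0 _)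
  have hψsupp : ∀ j y, ψ j y ≠ 0 → j ∈ P ∧ dist y (xs j) < 3/4 * (c' * R (xs j)) := by
    intro j y hy
    by_cases hj : j ∈ P
    · refine ⟨hj, ?_⟩
      rw [hψP j hj] at hy
      have : a j • (y - xs j) ∈ Function.support (η : Rd d → ℝ) := hy
      rw [η.support_eq, mem_ball_zero_iff, hnorm] at this
      exact (div_lt_iff₀ (hcR j)).1 this
    · rw [hψn j hj] at hy; exact absurd rfl hy
  -- the finite sets of neighbours
  let Fs : Rd d → Set ℕ := fun x =>
    {j | j ∈ P ∧ ∃ y, dist x y ≤ c' * R x ∧ dist y (xs j) ≤ c' * R (xs j)}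
  have hFs : ∀ x, ∀ j ∈ Fs x, R x ≤ K^2 * R (xs j) ∧ R (xs j) ≤ K^2 * R x ∧
      dist (xs j) x ≤ c' * (1 + K^2) * R x := by
    rintro x j ⟨-, y, hy1, hy2⟩
    obtain ⟨h1, h2⟩ := hslow2 x y hy1
    obtain ⟨h3, h4⟩ := hslow2 (xs j) y (by rw [dist_comm]; exact hy2)
    have h5 : R x ≤ K^2 * R (xs j) := by
      have := mul_le_mul_of_nonneg_left h4 hK0.le
      nlinarith
    have h6 : R (xs j) ≤ K^2 * R x := by
      have := mul_le_mul_of_nonneg_left h2 hK0.le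
      nlinarith
    refine ⟨h5, h6, ?_⟩
    have h7 := dist_triangle x y (xs j)
    rw [dist_comm (xs j) x]
    have h8 := mul_le_mul_of_nonneg_left h6 hc'0.le
    nlinarith
  have hFcard : ∀ x (s : Finset ℕ), (∀ j ∈ s, j ∈ Fs x) → s.card ≤ N := by
    intro x s hs
    refine hN xs x (R x) s (hR0 x) (fun i hi => (hFs x i (hs i hi)).2.2) ?_
    intro i hi j hj hij
    refine le_trans ?_ (hsep i (hs i hi).1 j (hs j hj).1 hij)
    have h1 := (hFs x i (hs i hi)).1
    rw [div_mul_eq_mul_div, div_le_iff₀ (by positivity), mul_assoc]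
    refine mul_le_mul_of_nonneg_left ?_ (by positivity)
    linarith
  have hFfin : ∀ x, (Fs x).Finite := by
    intro x
    by_contra hinf
    obtain ⟨t, ht, hcard⟩ := Set.Infinite.exists_subset_card_eq hinf (N+1)
    have := hFcard x t (fun j hj => ht hj)
    omega
  let F : Rd d → Finset ℕ := fun x => (hFfin x).toFinset
  have hmemF : ∀ x j, j ∈ F x ↔ j ∈ Fs x := fun x j => (hFfin x).mem_toFinset
  have hloc : ∀ x, ∀ᶠ y in nhds x, ∀ j, j ∉ F x → ψ j y = 0 := by
    intro x
    filter_upwards [Metric.closedBall_mem_nhds x (mul_pos hc'0 (hR0 x))] with y hy j hj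
    by_contra hne
    obtain ⟨hjP, hd⟩ := hψsupp j y hne
    refine hj ((hmemF x j).2 ⟨hjP, y, ?_, ?_⟩)
    · rw [dist_comm]; exact hy
    · have := hcR j; linarith
  have hρ0 : ∀ x, 0 ≤ (R x)⁻¹ := fun x => (inv_pos.2 (hR0 x)).le
  obtain ⟨g, hgsm, hsum, hbd⟩ := hBφ (fun x => (R x)⁻¹) F ψ hρ0 hψsm hψ1
    (fun x => hFcard x (F x) (fun j hj => (hmemF x j).1 hj)) hloc
    (by
      intro x j hj n
      have hjF := (hmemF x j).1 hj
      rw [hψP j hjF.1]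
      refine (bump_scale hηsm hB (ha j).le (xs j) x n).trans ?_
      rw [mul_assoc, ← mul_pow]
      refine mul_le_mul_of_nonneg_left (pow_le_pow_left₀ (ha j).le ?_ n) (hB0 n)
      have h1 := (hFs x j hjF).1
      have h2 := hR0 x
      have h3 := hR0 (xs j)
      change (c' * R (xs j))⁻¹ ≤ _
      rw [← div_eq_mul_inv, div_div, inv_le_iff_one_le_mul₀ (by positivity), div_mul_eq_mul_div,
        le_div_iff₀ (by positivity)]
      nlinarith [mul_le_mul_of_nonneg_left h1 hc'0.le])
    (by
      intro x
      obtain ⟨j, hj, hd⟩ := hcov x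
      refine ⟨j, ?_⟩
      rw [hψP j hj]
      refine η.one_of_mem_closedBall ?_
      rw [mem_closedBall_zero_iff, hnorm, div_le_iff₀ (hcR j)]
      change _ ≤ (1/2 : ℝ) * _
      linarith)
  have hφsm : ∀ j, ContDiff ℝ (⊤ : ℕ∞) (fun y => ψ j y * g y) := fun j => (hψsm j).mul hgsm
  have hts : ∀ j, tsupport (fun y => ψ j y * g y)
      ⊆ Metric.closedBall (xs j) (3/4 * (c' * R (xs j))) := by
    intro j
    refine closure_minimal ?_ Metric.isClosed_closedBall
    intro y hy
    have hne : ψ j y ≠ 0 := left_ne_zero_of_mul hy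
    exact (hψsupp j y hne).2.le
  have hcs : ∀ j, HasCompactSupport (fun y => ψ j y * g y) := fun j =>
    HasCompactSupport.of_support_subset_isCompact (isCompact_closedBall _ _)
      ((subset_tsupport _).trans (hts j))
  refine ⟨fun j y => ψ j y * g y, xs, fun j => ⟨hφsm j, hcs j⟩, hsum, ?_, ?_, ?_⟩
  · intro j
    refine (hts j).trans (Metric.closedBall_subset_ball ?_)
    have := hR0 (xs j)
    nlinarith
  · intro α x
    have hz : ∀ j, j ∉ F x → (pdMulti α (fun y => ψ j y * g y) x)^2 = 0 := by
      intro j hj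
      have he : (fun y => ψ j y * g y) =ᶠ[nhds x] fun _ => (0:ℝ) := by
        filter_upwards [hloc x] with y hy
        rw [hy j hj, zero_mul]
      have h1 := abs_pdMulti_le α (hφsm j) x
      rw [(he.iteratedFDeriv ℝ _).self_of_nhds] at h1
      have h2 : iteratedFDeriv ℝ (∑ i, α i) (fun _ : Rd d => (0:ℝ)) x = 0 := by
        have := iteratedFDeriv_fun_zero (𝕜 := ℝ) (E := Rd d) (F := ℝ) (n := ∑ i, α i)
        exact congrFun this x
      rw [h2, norm_zero] at h1
      have h3 : pdMulti α (fun y => ψ j y * g y) x = 0 :=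
        abs_eq_zero.1 (le_antisymm h1 (abs_nonneg _))
      rw [h3]; norm_num
    rw [tsum_eq_sum hz]
    have hRx := hR0 x
    calc ∑ j ∈ F x, (pdMulti α (fun y => ψ j y * g y) x)^2
        ≤ ∑ j ∈ F x, (Bφ (∑ i, α i) * (R x)⁻¹ ^ (∑ i, α i))^2 := by
          refine Finset.sum_le_sum fun j hj => ?_
          have h1 := (abs_pdMulti_le α (hφsm j) x).trans (hbd x j hj _)
          rw [← sq_abs]
          exact pow_le_pow_left₀ (abs_nonneg _) h1 2
      _ = (F x).card * (Bφ (∑ i, α i) * (R x)⁻¹ ^ (∑ i, α i))^2 := by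
          rw [Finset.sum_const, nsmul_eq_mul]
      _ ≤ N * (Bφ (∑ i, α i) * (R x)⁻¹ ^ (∑ i, α i))^2 :=
          mul_le_mul_of_nonneg_right
            (by exact_mod_cast hFcard x (F x) (fun j hj => (hmemF x j).1 hj)) (by positivity)
      _ = (N * (Bφ (∑ i, α i))^2) / (R x)^(2 * ∑ i, α i) := by
          rw [mul_pow, ← pow_mul, inv_pow, mul_comm (∑ i, α i) 2, ← mul_assoc, div_eq_mul_inv]
      _ ≤ (N * (Bφ (∑ i, α i))^2 + 1) / (R x)^(2 * ∑ i, α i) := by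
          gcongr
          linarith
  · intro k hk u hu hucs
    have hlf : LocallyFinite fun j => Function.support (ψ j) := by
      intro x
      refine ⟨_, hloc x, (F x).finite_toSet.subset ?_⟩
      rintro j ⟨y, hy1, hy2⟩
      by_contra hj
      exact hy1 (hy2 j hj)
    have hJf := hlf.finite_nonempty_inter_compact hucs
    set J : Finset ℕ := hJf.toFinset with hJ
    have hJz : ∀ j, j ∉ J → ∀ x, u x ≠ 0 → ψ j x = 0 := by
      intro j hj x hx
      by_contra hne
      refine hj (hJf.mem_toFinset.2 ⟨x, hne, subset_tsupport u hx⟩)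
    have hRHS : ∑' j, ∫ x : Rd d, (ψ j x * g x)^2 * ‖u x‖^2 / (R (xs j)) ^ (2*k)
        = ∑ j ∈ J, ∫ x : Rd d, (ψ j x * g x)^2 * ‖u x‖^2 / (R (xs j)) ^ (2*k) := by
      refine tsum_eq_sum fun j hj => ?_
      have : ∀ x, (ψ j x * g x)^2 * ‖u x‖^2 / (R (xs j)) ^ (2*k) = 0 := by
        intro x
        by_cases hx : u x = 0
        · simp [hx]
        · simp [hJz j hj x hx]
      simp [this]
    have hInteg : ∀ j, Integrable fun x : Rd d =>
        (ψ j x * g x)^2 * ‖u x‖^2 / (R (xs j)) ^ (2*k) := by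
      intro j
      refine Continuous.integrable_of_hasCompactSupport ?_ ?_
      · have h1 := (hφsm j).continuous
        have h2 := hu.continuous
        exact ((h1.pow 2).mul (h2.norm.pow 2)).div_const _
      · refine hucs.mono ?_
        intro x hx
        rw [Function.mem_support] at hx ⊢
        intro h0
        apply hx
        simp [h0]
    rw [hRHS, ← integral_finsetSum J fun j _ => hInteg j, ← integral_const_mul]
    refine integral_mono_of_nonneg ?_ ((integrable_finsetSum J fun j _ => hInteg j).const_mul _) ?_
    · refine Filter.Eventually.of_forall fun x => ?_
      have := hR0 x
      simp only [Pi.zero_apply]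
      positivity
    · refine Filter.Eventually.of_forall fun x => ?_
      simp only
      by_cases hx : u x = 0
      · simp [hx]
      have hone : ∑ j ∈ J, (ψ j x * g x)^2 = 1 := by
        rw [← hsum x]
        symm
        refine tsum_eq_sum fun j hj => ?_
        rw [hJz j hj x hx]; norm_num
      have hRx := hR0 x
      calc ‖u x‖^2 / (R x)^(2*k) = ∑ j ∈ J, (ψ j x * g x)^2 * (‖u x‖^2 / (R x)^(2*k)) := by
            rw [← Finset.sum_mul, hone, one_mul]
        _ ≤ ∑ j ∈ J, K^4 * ((ψ j x * g x)^2 * ‖u x‖^2 / (R (xs j)) ^ (2*k)) := by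
            refine Finset.sum_le_sum fun j _ => ?_
            by_cases hne : ψ j x = 0
            · simp [hne]
            have hd := (hψsupp j x hne).2
            have hRj := hR0 (xs j)
            have h1 : R (xs j) ≤ K * R x := (hslow2 (xs j) x (by
              rw [dist_comm]; have := hcR j; linarith)).1
            have h2 : R (xs j)^(2*k) ≤ K^4 * R x^(2*k) := by
              calc R (xs j)^(2*k) ≤ (K * R x)^(2*k) := pow_le_pow_left₀ hRj.le h1 _
                _ = K^(2*k) * R x^(2*k) := mul_pow _ _ _
                _ ≤ K^4 * R x^(2*k) := by
                  refine mul_le_mul_of_nonneg_right (pow_le_pow_right₀ hK ?_) (by positivity)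
                  rcases hk with h | h <;> omega
            have h3 : 1 / R x^(2*k) ≤ K^4 / R (xs j)^(2*k) := by
              rw [div_le_div_iff₀ (by positivity) (by positivity), one_mul]
              exact h2
            have h4 := mul_le_mul_of_nonneg_left h3
              (by positivity : 0 ≤ (ψ j x * g x)^2 * ‖u x‖^2)
            calc (ψ j x * g x)^2 * (‖u x‖^2 / (R x)^(2*k))
                = (ψ j x * g x)^2 * ‖u x‖^2 * (1 / R x^(2*k)) := by ring
              _ ≤ _ := h4
              _ = _ := by ring
        _ = K^4 * ∑ j ∈ J, (ψ j x * g x)^2 * ‖u x‖^2 / (R (xs j)) ^ (2*k) := by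
            rw [Finset.mul_sum]

/-- existence of an adapted quadratic partition of unity, with
constants independent of `μ`. -/
theorem statement_12 (d p r : ℕ) (hd : 1 ≤ d) (hr : 1 ≤ r)
    (A : Fin d → Rd d → ℝ) (U : Fin p → Rd d → ℝ) (V : Rd d → ℝ)
    (hA : ∀ j, ContDiff ℝ (⊤ : ℕ∞) (A j)) (hU : ∀ ℓ, ContDiff ℝ (⊤ : ℕ∞) (U ℓ)) (hV : ContDiff ℝ (⊤ : ℕ∞) V)
    (C₀ : ℝ) (hC₀ : 0 < C₀)
    (hT : ∀ x, mq A U V (r+1) x ≤ C₀ * mr A U V r x) :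
    ∃ (Chat : (Fin d → ℕ) → ℝ) (Chat' : ℝ), (∀ α, 0 < Chat α) ∧ 0 < Chat' ∧
      ∀ μ : ℝ, 1 ≤ μ →
        ∃ (φ : ℕ → Rd d → ℝ) (xs : ℕ → Rd d),
          (∀ j, ContDiff ℝ (⊤ : ℕ∞) (φ j) ∧ HasCompactSupport (φ j)) ∧
          (∀ x, ∑' j, (φ j x)^2 = 1) ∧
          (∀ j, tsupport (φ j) ⊆ Metric.ball (xs j) (Rfun A U V r (xs j) μ)) ∧
          (∀ α : Fin d → ℕ, ∀ x : Rd d,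
            (∑' j, (pdMulti α (φ j) x)^2)
              ≤ Chat α / (Rfun A U V r x μ) ^ (2 * ∑ i, α i)) ∧
          (∀ k : ℕ, k = 1 ∨ k = 2 →
            ∀ u : Rd d → ℂ, ContDiff ℝ (⊤ : ℕ∞) u → HasCompactSupport u →
              (∫ x : Rd d, ‖u x‖^2 / (Rfun A U V r x μ) ^ (2*k))
                ≤ Chat' * ∑' j, ∫ x : Rd d,
                    (φ j x)^2 * ‖u x‖^2 / (Rfun A U V r (xs j) μ) ^ (2*k)) := by
  obtain ⟨c, hc0, hc1, hslow⟩ := R_slow (r := r) hA hU hV hC₀ hT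
  obtain ⟨Chat, Chat', h1, h2, h3⟩ := exists_partition d hc0 hc1 (by norm_num : (1:ℝ) ≤ 4)
  refine ⟨Chat, Chat', h1, h2, fun μ hμ => ?_⟩
  exact h3 (fun x => Rfun A U V r x μ) (fun x => R_pos A U V r x μ hμ)
    (fun x => R_le_one A U V r x μ hμ) (hslow μ hμ)


end
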